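/- There exists an infinite binary word w that is (8/3)⁺-free such that the set of nonempty binary words x for which both x and its complement x̄ are factors of w has at most 24 elements. -/

import Mathlib

/-- `x` occurs as a contiguous block in the infinite word `w : ℕ → α`. -/
def FactorN {α : Type*} (w : ℕ → α) (x : List α) : Prop :=
  ∃ i : ℕ, x = (List.range x.length).map fun k => w (i + k)

/-- the finite word `u` has period `p ≥ 1`. -/
def HasPeriod {α : Type*} (u : List α) (p : ℕ) : Prop :=
  1 ≤ p ∧ ∀ i : ℕ, i + p < u.length → u[i]? = u[i + p]?

/-- the smallest period of `u`. -/
noncomputable def minPeriod {α : Type*} (u : List α) : ℕ :=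
  sInf {p | HasPeriod u p}

/-- the exponent of `u`: its length divided by its smallest period. -/
noncomputable def expo {α : Type*} (u : List α) : ℝ :=
  (u.length : ℝ) / (minPeriod u : ℝ)

/-- the complement of a binary word: each letter is flipped. -/
def comp (x : List Bool) : List Bool := x.map fun b => !b

/-- The Thue–Morse word. -/
def thueMorse : ℕ → Bool
  | 0 => false
  | n + 1 => xor (thueMorse ((n + 1) / 2)) ((n + 1).bodd)

theorem thueMorse_eq_xor (n : ℕ) : thueMorse n = xor (thueMorse (n / 2)) n.bodd := by
  cases n with
  | zero => simp [thueMorse]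
  | succ n => rw [thueMorse]

theorem thueMorse_two_mul (n : ℕ) : thueMorse (2 * n) = thueMorse n := by
  rw [thueMorse_eq_xor]; simp

theorem thueMorse_two_mul_add_one (n : ℕ) : thueMorse (2 * n + 1) = !thueMorse n := by
  rw [thueMorse_eq_xor, show (2 * n + 1) / 2 = n by omega]; simp

theorem thueMorse_cube_free (i : ℕ) (h₀ : thueMorse i = thueMorse (i + 1))
    (h₁ : thueMorse (i + 1) = thueMorse (i + 2)) : False := by
  obtain ⟨m, rfl | rfl⟩ := Nat.even_or_odd' i
  · rw [thueMorse_two_mul, thueMorse_two_mul_add_one] at h₀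
    simp at h₀
  · rw [show 2 * m + 1 + 1 = 2 * (m + 1) by ring, show 2 * m + 1 + 2 = 2 * (m + 1) + 1 by ring,
      thueMorse_two_mul, thueMorse_two_mul_add_one] at h₁
    simp at h₁

/-- The Thue–Morse word does not change at two successive odd positions. -/
theorem thueMorse_not_alternating (m : ℕ)
    (h₀ : thueMorse (2 * m + 1) ≠ thueMorse (2 * m + 2))
    (h₁ : thueMorse (2 * m + 3) ≠ thueMorse (2 * m + 4)) : False := by
  rw [show 2 * m + 2 = 2 * (m + 1) by ring, thueMorse_two_mul, thueMorse_two_mul_add_one] at h₀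
  rw [show 2 * m + 3 = 2 * (m + 1) + 1 by ring, show 2 * m + 4 = 2 * (m + 2) by ring,
    thueMorse_two_mul, thueMorse_two_mul_add_one] at h₁
  exact thueMorse_cube_free m (by simpa using h₀) (by simpa using h₁)

theorem thueMorse_ne_succ_of_even (m : ℕ) : thueMorse (2 * m) ≠ thueMorse (2 * m + 1) := by
  rw [thueMorse_two_mul, thueMorse_two_mul_add_one]; simp

theorem thueMorse_overlap_free (p : ℕ) (hp : 1 ≤ p) (i : ℕ)
    (h : ∀ k ≤ p, thueMorse (i + k) = thueMorse (i + k + p)) : False := by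
  induction p using Nat.strong_induction_on generalizing i with
  | _ p ih =>
  obtain ⟨q, rfl | rfl⟩ := Nat.even_or_odd' p
  · refine ih q (by omega) (by omega) (i / 2) fun j hj => ?_
    have hj := h (2 * j) (by omega)
    rw [thueMorse_eq_xor (i + 2 * j), thueMorse_eq_xor (i + 2 * j + 2 * q),
      show (i + 2 * j) / 2 = i / 2 + j by omega,
      show (i + 2 * j + 2 * q) / 2 = i / 2 + j + q by omega] at hj
    simpa using hj
  · rcases Nat.eq_zero_or_pos q with rfl | hq
    · exact thueMorse_cube_free i (h 0 (by omega)) (h 1 (by omega))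
    have h₀ := h 0 (by omega)
    have h₁ := h 1 (by omega)
    have h₂ := h 2 (by omega)
    have h₃ := h 3 (by omega)
    obtain ⟨m, rfl | rfl⟩ := Nat.even_or_odd' i
    · have e₀ := thueMorse_ne_succ_of_even m
      have e₁ := thueMorse_ne_succ_of_even (m + 1)
      refine thueMorse_not_alternating (m + q) ?_ ?_ <;> grind
    · have e₀ := thueMorse_ne_succ_of_even (m + q + 1)
      have e₁ := thueMorse_ne_succ_of_even (m + q + 2)
      refine thueMorse_not_alternating m ?_ ?_ <;> grind

/-- The images of the two letters under a 24-uniform morphism. -/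
def block : Bool → List Bool
  | false => [true, false, true, false, false, true, true, false, false, true, false, false,
      true, false, true, false, false, true, false, false, true, true, false, false]
  | true => [true, false, true, false, false, true, true, false, false, true, false, true,
      false, false, true, false, false, true, true, false, false, true, false, false]

/-- The image of an infinite word under the morphism `block`. -/
def blockImage (u : ℕ → Bool) (n : ℕ) : Bool :=
  (block (u (n / 24))).getD (n % 24) false

theorem blockImage_add (u : ℕ → Bool) (m n : ℕ) :
    blockImage u (24 * m + n) = blockImage (fun j => u (m + j)) n := by
  unfold blockImage
  rw [show (24 * m + n) / 24 = m + n / 24 by omega, show (24 * m + n) % 24 = n % 24 by omega]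

theorem blockImage_congr {u v : ℕ → Bool} {l n : ℕ} (h : ∀ j < l, u j = v j) (hn : n < 24 * l) :
    blockImage u n = blockImage v n := by
  unfold blockImage
  rw [h _ (by omega)]

/-- The image of the finite word `u`, extended by zeros. -/
def listImage (u : List Bool) : ℕ → Bool :=
  blockImage fun j => u.getD j false

theorem blockImage_eq_listImage_two (u : ℕ → Bool) (i k : ℕ) (hk : k ≤ 24) :
    blockImage u (i + k) = listImage [u (i / 24), u (i / 24 + 1)] (i % 24 + k) := by
  rw [show i + k = 24 * (i / 24) + (i % 24 + k) by omega, blockImage_add]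
  refine blockImage_congr (l := 2) (fun j hj => ?_) (by omega)
  interval_cases j <;> rfl

theorem blockImage_eq_listImage_four (u : ℕ → Bool) (i k : ℕ) (hk : k ≤ 72) :
    blockImage u (i + k) =
      listImage [u (i / 24), u (i / 24 + 1), u (i / 24 + 2), u (i / 24 + 3)] (i % 24 + k) := by
  rw [show i + k = 24 * (i / 24) + (i % 24 + k) by omega, blockImage_add]
  refine blockImage_congr (l := 4) (fun j hj => ?_) (by omega)
  interval_cases j <;> rfl

/-- The common prefix of length 7 of both blocks occurs only at block boundaries. -/
theorem marker_sync : ∀ a b : Bool, ∀ r < 24,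
    (∀ k < 7, listImage [a, b] (r + k) = (block false).getD k false) → r = 0 := by
  decide +kernel

theorem block_prefix : ∀ a : Bool, ∀ k < 7,
    (block a).getD k false = (block false).getD k false := by
  decide

theorem listImage_no_short_repetition : ∀ a b c d : Bool, ¬(a = b ∧ b = c) → ¬(b = c ∧ c = d) →
    ∀ p ∈ 24 :: List.range' 1 17, ∀ r < 24,
      ∃ k < 41, 3 * k ≤ 5 * p ∧ listImage [a, b, c, d] (r + k) ≠
        listImage [a, b, c, d] (r + (k + p)) := by
  decide +kernel

/-- A binary word that is `(8/3)⁺`-free and has few complementary factors. -/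
def complementPoorWord : ℕ → Bool := blockImage thueMorse

theorem complementPoorWord_block (m k : ℕ) (hk : k < 24) :
    complementPoorWord (24 * m + k) = (block (thueMorse m)).getD k false := by
  unfold complementPoorWord blockImage
  rw [show (24 * m + k) / 24 = m by omega, show (24 * m + k) % 24 = k by omega]

theorem dvd_of_repetition {i p : ℕ}
    (h : ∀ k < 30, complementPoorWord (i + k) = complementPoorWord (i + k + p)) : 24 ∣ p := by
  obtain ⟨m, s, hs, hm⟩ : ∃ m s, s < 24 ∧ i + s = 24 * m :=
    ⟨(i + 23) / 24, 24 * ((i + 23) / 24) - i, by omega, by omega⟩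
  have := marker_sync (thueMorse ((24 * m + p) / 24)) (thueMorse ((24 * m + p) / 24 + 1))
    ((24 * m + p) % 24) (by omega) fun k hk => by
      rw [← blockImage_eq_listImage_two _ _ _ (by omega), ← block_prefix (thueMorse m) k hk,
        ← complementPoorWord_block m k (by omega), ← hm, add_assoc i s k,
        h (s + k) (by omega)]
      exact congrArg complementPoorWord (by ring)
  omega

theorem complementPoorWord_no_repetition (p : ℕ) (hp : 1 ≤ p) (i : ℕ)
    (h : ∀ k, 3 * k ≤ 5 * p → complementPoorWord (i + k) = complementPoorWord (i + k + p)) :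
    False := by
  by_cases hs : p ∈ 24 :: List.range' 1 17
  · have hp' : p ≤ 24 := by simp at hs; omega
    obtain ⟨k, hk, hkp, hne⟩ := listImage_no_short_repetition (thueMorse (i / 24))
      (thueMorse (i / 24 + 1)) (thueMorse (i / 24 + 2)) (thueMorse (i / 24 + 3))
      (fun e => thueMorse_cube_free _ e.1 e.2) (fun e => thueMorse_cube_free _ e.1 e.2)
      p hs (i % 24) (by omega)
    rw [← blockImage_eq_listImage_four _ _ _ (by omega),
      ← blockImage_eq_listImage_four _ _ _ (by omega), ← add_assoc] at hne
    exact hne (h k hkp)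
  · have hp' : 18 ≤ p ∧ p ≠ 24 := by simp at hs; omega
    obtain ⟨q, rfl⟩ := dvd_of_repetition fun k hk => h k (by omega)
    refine thueMorse_overlap_free q (by omega) ((i + 12) / 24) fun j hj => ?_
    have key : ∀ m, complementPoorWord (24 * m + 11) = thueMorse m := fun m => by
      rw [complementPoorWord_block m 11 (by omega)]
      cases thueMorse m <;> rfl
    have e := h (24 * ((i + 12) / 24 + j) + 11 - i) (by omega)
    rw [show i + (24 * ((i + 12) / 24 + j) + 11 - i) = 24 * ((i + 12) / 24 + j) + 11 by omega,
      key, show 24 * ((i + 12) / 24 + j) + 11 + 24 * q = 24 * ((i + 12) / 24 + j + q) + 11 by ring,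
      key] at e
    exact e

theorem HasPeriod.length {α : Type*} {u : List α} (hu : u ≠ []) : HasPeriod u u.length :=
  ⟨List.length_pos_iff.2 hu, fun i hi => by omega⟩

theorem hasPeriod_minPeriod {α : Type*} {u : List α} (hu : u ≠ []) : HasPeriod u (minPeriod u) :=
  Nat.sInf_mem (s := {p | HasPeriod u p}) ⟨_, HasPeriod.length hu⟩

theorem FactorN.exists_getElem? {α : Type*} {w : ℕ → α} {x : List α} (h : FactorN w x) :
    ∃ i, ∀ k < x.length, x[k]? = some (w (i + k)) := by
  obtain ⟨i, hi⟩ := h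
  refine ⟨i, fun k hk => ?_⟩
  rw [hi]
  simp [hk]

theorem FactorN.take {α : Type*} {w : ℕ → α} {x : List α} (h : FactorN w x) (n : ℕ) :
    FactorN w (x.take n) := by
  obtain ⟨i, hi⟩ := h
  refine ⟨i, ?_⟩
  conv_lhs => rw [hi]
  rw [← List.map_take, List.take_range, List.length_take]

theorem expo_le_of_factorN {x : List Bool} (h : FactorN complementPoorWord x) (hx : x ≠ []) :
    expo x ≤ (8 : ℝ) / 3 := by
  obtain ⟨hp, hper⟩ := hasPeriod_minPeriod hx
  unfold expo
  rw [div_le_div_iff₀ (by exact_mod_cast hp) (by norm_num)]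
  by_contra! hlt
  have hlt : 8 * minPeriod x < x.length * 3 := by exact_mod_cast hlt
  obtain ⟨i, hi⟩ := h.exists_getElem?
  refine complementPoorWord_no_repetition _ hp i fun k hk => ?_
  have e := hper k (by omega)
  rw [hi k (by omega), hi _ (by omega)] at e
  simpa [add_assoc] using e

/-- All factors of length `l ≤ 25` of images of words under `block`. -/
def shortFactors (l : ℕ) : List (List Bool) :=
  [[false, false], [false, true], [true, false], [true, true]].flatMap fun u =>
    (List.range 24).map fun r => (List.range l).map fun k => listImage u (r + k)

theorem FactorN.mem_shortFactors {x : List Bool} (h : FactorN complementPoorWord x)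
    (hl : x.length ≤ 7) : x ∈ shortFactors x.length := by
  obtain ⟨i, hi⟩ := h
  refine List.mem_flatMap.2 ⟨[thueMorse (i / 24), thueMorse (i / 24 + 1)], ?_,
    List.mem_map.2 ⟨i % 24, List.mem_range.2 (by omega), ?_⟩⟩
  · cases thueMorse (i / 24) <;> cases thueMorse (i / 24 + 1) <;> simp
  · conv_rhs => rw [hi]
    refine List.map_congr_left fun k hk => ?_
    rw [List.mem_range] at hk
    exact (blockImage_eq_listImage_two _ _ _ (by omega)).symm

/-- The nonempty words `x` such that both `x` and its complement occur in the word. -/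
def complementaryFactors : Finset (List Bool) :=
  ((List.range' 1 6).flatMap fun l =>
    (shortFactors l).filter fun x => comp x ∈ shortFactors l).toFinset

theorem card_complementaryFactors : complementaryFactors.card ≤ 24 := by
  decide +kernel

theorem comp_notMem_shortFactors_seven : ∀ x ∈ shortFactors 7, comp x ∉ shortFactors 7 := by
  decide +kernel

theorem comp_take (x : List Bool) (n : ℕ) : comp (x.take n) = (comp x).take n :=
  List.map_take

theorem mem_complementaryFactors {x : List Bool} (hx : x ≠ []) (h : FactorN complementPoorWord x)
    (hc : FactorN complementPoorWord (comp x)) : x ∈ complementaryFactors := by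
  have hlen : (comp x).length = x.length := List.length_map _
  have hpos := List.length_pos_iff.2 hx
  by_cases hl : x.length ≤ 6
  · have hm := h.mem_shortFactors (by omega)
    have hmc := hc.mem_shortFactors (by omega)
    rw [hlen] at hmc
    refine List.mem_toFinset.2 (List.mem_flatMap.2 ⟨x.length, ?_, ?_⟩)
    · rw [List.mem_range'_1]; omega
    · simpa using ⟨hm, hmc⟩
  · have hm := (h.take 7).mem_shortFactors (by simp)
    have hmc := (hc.take 7).mem_shortFactors (by simp)
    rw [List.length_take, min_eq_left (by omega)] at hm hmc
    rw [← comp_take] at hmc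
    exact absurd hmc (comp_notMem_shortFactors_seven _ hm)

theorem stmt9 :
    ∃ w : ℕ → Bool,
      (∀ x : List Bool, FactorN w x → x ≠ [] → expo x ≤ (8 : ℝ) / 3) ∧
      ∃ F : Finset (List Bool), F.card ≤ 24 ∧
        ∀ x : List Bool, x ≠ [] → FactorN w x → FactorN w (comp x) → x ∈ F :=
  ⟨complementPoorWord, fun _ h hx => expo_le_of_factorN h hx, complementaryFactors,
    card_complementaryFactors, fun _ hx h hc => mem_complementaryFactors hx h hc⟩
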